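/- Let 𝒟 be a testing context. (1) If μ1 ∼p† μ2 then μ1 =◇^𝒟 μ2 and μ1 =□^𝒟 μ2. (2) For any relation R on D(P_RCCS): if the 𝒟-extensional closure R^𝒟 is probabilistically equipollent then R ⊆ =◇^𝒟, and if R^𝒟 is probabilistically strongly equipollent then R ⊆ =□^𝒟. (3) For processes P, Q ∈ P_RCCS: if χmay_𝓛(ϑ[P]) = χmay_𝓛(ϑ[Q]) for every 1-ary distribution ϑ then δ_P =◇^𝒟 δ_Q, and if χfair_𝓛(ϑ[P]) = χfair_𝓛(ϑ[Q]) for every 1-ary distribution ϑ then δ_P =□^𝒟 δ_Q. -/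

import Mathlib

open scoped Classical

/-! ## Channels, actions, RCCS terms -/

/-- Channels, drawn from an infinite set. -/
abbrev Chan := ℕ

/-- Actions: input/output labels over channels, the silent action `τ`, and the
distinguished success action `ω` (used only by observers). -/
inductive Act where
  | inp : Chan → Act
  | out : Chan → Act
  | tau : Act
  | omega : Act
deriving DecidableEq

/-- `α` is an external label, i.e. a member of `𝓛 = N ∪ N̄`. -/
def Act.IsLabel : Act → Prop
  | .inp _ => True
  | .out _ => True
  | _ => False

/-- Complementary labels (for communication). -/
def Act.Comp : Act → Act → Prop := fun x y =>
  ∃ a, (x = .inp a ∧ y = .out a) ∨ (x = .out a ∧ y = .inp a)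

/-- `β, β̄ ∉ L`: the action is not blocked by the localization `(L)-`. -/
def Act.Allowed (L : Finset Chan) : Act → Prop
  | .inp a => a ∉ L
  | .out a => a ∉ L
  | _ => True

/-- Channels occurring in an action. -/
def Act.chans : Act → Finset Chan
  | .inp a => {a}
  | .out a => {a}
  | _ => ∅

/-- RCCS (and RCCS^ω) terms, with de Bruijn indices for process variables.
`sum k acts conts` is the nondeterministic choice `Σ_{i∈I} α_i.T_i` over the
nonempty finite index set `I = Fin (k+1)`, and `oplus k w conts` is the
probabilistic choice `⊕_{i∈I} p_i τ.T_i`. `fix T` is `μX.T` (binding index 0). -/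
inductive Tm where
  | nil : Tm
  | var : ℕ → Tm
  | sum : (k : ℕ) → (Fin (k+1) → Act) → (Fin (k+1) → Tm) → Tm
  | oplus : (k : ℕ) → (Fin (k+1) → ℝ) → (Fin (k+1) → Tm) → Tm
  | par : Tm → Tm → Tm
  | loc : Finset Chan → Tm → Tm
  | fix : Tm → Tm

/-- Substitution `T{P/X}` of a (closed) term `P` for the de Bruijn variable `n`. -/
def Tm.subst (P : Tm) : ℕ → Tm → Tm
  | _, .nil => .nil
  | n, .var m => if m = n then P else .var m
  | n, .sum k a c => .sum k a (fun i => Tm.subst P n (c i))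
  | n, .oplus k w c => .oplus k w (fun i => Tm.subst P n (c i))
  | n, .par S T => .par (Tm.subst P n S) (Tm.subst P n T)
  | n, .loc L T => .loc L (Tm.subst P n T)
  | n, .fix T => .fix (Tm.subst P (n+1) T)

/-- `T` has all its free variables among the first `n` de Bruijn indices.
`ClosedAt 0 T` means `T` is closed; `ClosedAt 1 T` means at most one free variable. -/
def Tm.ClosedAt : ℕ → Tm → Prop
  | _, .nil => True
  | n, .var m => m < n
  | n, .sum _ _ c => ∀ i, Tm.ClosedAt n (c i)
  | n, .oplus _ _ c => ∀ i, Tm.ClosedAt n (c i)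
  | n, .par S T => Tm.ClosedAt n S ∧ Tm.ClosedAt n T
  | n, .loc _ T => Tm.ClosedAt n T
  | n, .fix T => Tm.ClosedAt (n+1) T

/-- The success action `ω` does not occur in `T` (so `T` is a genuine RCCS term). -/
def Tm.NoOmega : Tm → Prop
  | .nil => True
  | .var _ => True
  | .sum _ a c => (∀ i, a i ≠ Act.omega) ∧ (∀ i, Tm.NoOmega (c i))
  | .oplus _ _ c => ∀ i, Tm.NoOmega (c i)
  | .par S T => Tm.NoOmega S ∧ Tm.NoOmega T
  | .loc _ T => Tm.NoOmega T
  | .fix T => Tm.NoOmega T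

/-- No probabilistic choice occurs in `T` (so `T` is a CCS term). -/
def Tm.NoOplus : Tm → Prop
  | .nil => True
  | .var _ => True
  | .sum _ _ c => ∀ i, Tm.NoOplus (c i)
  | .oplus _ _ _ => False
  | .par S T => Tm.NoOplus S ∧ Tm.NoOplus T
  | .loc _ T => Tm.NoOplus T
  | .fix T => Tm.NoOplus T

/-- The channels `N(T)` occurring in a term. -/
def Tm.chans : Tm → Finset Chan
  | .nil => ∅
  | .var _ => ∅
  | .sum _ a c =>
      (Finset.univ.sup fun i => (a i).chans) ∪ (Finset.univ.sup fun i => Tm.chans (c i))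
  | .oplus _ _ c => Finset.univ.sup fun i => Tm.chans (c i)
  | .par S T => S.chans ∪ T.chans
  | .loc L T => L ∪ T.chans
  | .fix T => T.chans

/-- Renaming of channels in an action. -/
def Act.rename (f : Chan → Chan) : Act → Act
  | .inp a => .inp (f a)
  | .out a => .out (f a)
  | x => x

/-- Renaming `T[f]` of the global channels of a term (local channels are untouched). -/
def Tm.rename : (Chan → Chan) → Tm → Tm
  | _, .nil => .nil
  | _, .var m => .var m
  | f, .sum k a c => .sum k (fun i => (a i).rename f) (fun i => Tm.rename f (c i))
  | f, .oplus k w c => .oplus k w (fun i => Tm.rename f (c i))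
  | f, .par S T => .par (Tm.rename f S) (Tm.rename f T)
  | f, .loc L T => .loc L (Tm.rename (fun a => if a ∈ L then a else f a) T)
  | f, .fix T => .fix (Tm.rename f T)

/-- `P` is an RCCS process: closed and without the success action. -/
def Tm.IsProc (P : Tm) : Prop := Tm.ClosedAt 0 P ∧ Tm.NoOmega P

/-- `P` is a CCS process: a process without probabilistic choice. -/
def Tm.IsCCS (P : Tm) : Prop := P.IsProc ∧ Tm.NoOplus P

/-! ## Finitely supported distributions -/

/-- Finitely supported probability distributions on `α`. -/
structure FinDist (α : Type) where
  toFun : α → ℝ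
  nonneg : ∀ a, 0 ≤ toFun a
  finite_support : (Function.support toFun).Finite
  sum_one : ∑ᶠ a, toFun a = 1

namespace FinDist

/-- The probability `μ(φ)` that a predicate (set) `φ` holds under `μ`. -/
noncomputable def mass {α : Type} (μ : FinDist α) (φ : Set α) : ℝ :=
  ∑ᶠ a ∈ φ, μ.toFun a

/-- The Dirac distribution `δ_P`. -/
noncomputable def dirac {α : Type} (P : α) : FinDist α where
  toFun := fun Q => if Q = P then 1 else 0
  nonneg := by intro a; by_cases h : a = P <;> simp [h]
  finite_support := by
    apply Set.Finite.subset (Set.finite_singleton P)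
    intro a ha
    by_contra h
    simp only [Set.mem_singleton_iff] at h
    simp [Function.mem_support, h] at ha
  sum_one := by
    rw [finsum_eq_single _ P (fun b hb => by simp [hb])]
    simp

/-- Pushforward of a finitely supported distribution along a map. -/
noncomputable def map {α β : Type} (g : α → β) (μ : FinDist α) : FinDist β where
  toFun := fun b => ∑ᶠ a ∈ {a | g a = b}, μ.toFun a
  nonneg := by
    intro b
    exact finsum_nonneg fun a => finsum_nonneg fun _ => μ.nonneg a
  finite_support := by
    apply Set.Finite.subset (μ.finite_support.image g)
    intro b hb
    rw [Function.mem_support] at hb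
    by_contra h
    apply hb
    apply finsum_mem_eq_zero_of_forall_eq_zero
    intro a ha
    by_contra ha0
    exact h ⟨a, Function.mem_support.mpr ha0, ha⟩
  sum_one := by
    classical
    set s := μ.finite_support.toFinset with hs
    have hfib : ∀ b : β, (∑ᶠ a ∈ {a | g a = b}, μ.toFun a)
        = ∑ a ∈ s.filter (fun a => g a = b), μ.toFun a := by
      intro b
      apply finsum_mem_eq_sum_of_inter_support_eq
      ext a
      simp only [Set.mem_inter_iff, Set.mem_setOf_eq, Finset.coe_filter,
        Set.Finite.mem_toFinset, Function.mem_support, hs]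
      tauto
    have hsub : Function.support (fun b : β => ∑ᶠ a ∈ {a | g a = b}, μ.toFun a) ⊆
        ↑(s.image g) := by
      intro b hb
      rw [Function.mem_support, hfib] at hb
      obtain ⟨a, ha, hne⟩ := Finset.exists_ne_zero_of_sum_ne_zero hb
      rw [Finset.mem_filter] at ha
      simp only [Finset.coe_image, Set.mem_image, Finset.mem_coe]
      exact ⟨a, ha.1, ha.2⟩
    rw [finsum_eq_finset_sum_of_support_subset _ hsub]
    calc ∑ b ∈ s.image g, ∑ᶠ a ∈ {a | g a = b}, μ.toFun a
        = ∑ b ∈ s.image g, ∑ a ∈ s.filter (fun a => g a = b), μ.toFun a :=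
          Finset.sum_congr rfl fun b _ => hfib b
      _ = ∑ a ∈ s, μ.toFun a :=
          Finset.sum_fiberwise_of_maps_to (fun a ha => Finset.mem_image_of_mem g ha)
            μ.toFun
      _ = 1 := by rw [← finsum_eq_sum μ.toFun μ.finite_support]; exact μ.sum_one

/-- The product of two finitely supported distributions. -/
noncomputable def prod {α β : Type} (μ : FinDist α) (ν : FinDist β) :
    FinDist (α × β) where
  toFun := fun x => μ.toFun x.1 * ν.toFun x.2
  nonneg := fun x => mul_nonneg (μ.nonneg _) (ν.nonneg _)
  finite_support := by
    apply Set.Finite.subset (μ.finite_support.prod ν.finite_support)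
    intro x hx
    rw [Function.mem_support] at hx
    have h := mul_ne_zero_iff.mp hx
    exact ⟨Function.mem_support.mpr h.1, Function.mem_support.mpr h.2⟩
  sum_one := by
    classical
    have hsub : Function.support (fun x : α × β => μ.toFun x.1 * ν.toFun x.2) ⊆
        ↑(μ.finite_support.toFinset ×ˢ ν.finite_support.toFinset) := by
      intro x hx
      rw [Function.mem_support] at hx
      have h := mul_ne_zero_iff.mp hx
      simp only [Finset.coe_product, Set.mem_prod, Set.Finite.coe_toFinset]
      exact ⟨h.1, h.2⟩
    rw [finsum_eq_finset_sum_of_support_subset _ hsub, Finset.sum_product]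
    have h1 : ∑ a ∈ μ.finite_support.toFinset, μ.toFun a = 1 := by
      rw [← finsum_eq_sum μ.toFun μ.finite_support]; exact μ.sum_one
    have h2 : ∑ b ∈ ν.finite_support.toFinset, ν.toFun b = 1 := by
      rw [← finsum_eq_sum ν.toFun ν.finite_support]; exact ν.sum_one
    calc ∑ a ∈ μ.finite_support.toFinset, ∑ b ∈ ν.finite_support.toFinset,
          μ.toFun a * ν.toFun b
        = ∑ a ∈ μ.finite_support.toFinset, μ.toFun a * 1 := by
          refine Finset.sum_congr rfl fun a _ => ?_
          rw [← Finset.mul_sum, h2]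
      _ = 1 := by simpa using h1

/-- Parallel composition `μ | ν` of distributions:
`(μ|ν)(A|B) = μ(A)·ν(B)`. -/
noncomputable def parD (μ ν : FinDist Tm) : FinDist Tm :=
  (μ.prod ν).map fun x => Tm.par x.1 x.2

/-- Localization `(L)μ` of a distribution. -/
noncomputable def locD (L : Finset Chan) (μ : FinDist Tm) : FinDist Tm :=
  μ.map (Tm.loc L)

/-- Renaming `μ[f]` of a distribution. -/
noncomputable def renameD (f : Chan → Chan) (μ : FinDist Tm) : FinDist Tm :=
  μ.map (Tm.rename f)

/-- Instantiation `ϑ[P]` of a 1-ary distribution `ϑ` at the process `P`. -/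
noncomputable def instD (ϑ : FinDist Tm) (P : Tm) : FinDist Tm :=
  ϑ.map (fun T => Tm.subst P 0 T)

/-- Every element of the support is a process (`μ ∈ D(P_RCCS)`). -/
def IsProcDist (μ : FinDist Tm) : Prop := ∀ P, μ.toFun P ≠ 0 → P.IsProc

/-- All channels occurring in (the support of) `μ` lie in `L`. -/
def chansIn (μ : FinDist Tm) (L : Finset Chan) : Prop :=
  ∀ P, μ.toFun P ≠ 0 → P.chans ⊆ L

/-- The channel `a` occurs in (the support of) `μ`, i.e. `a ∈ N(μ)`. -/
def hasChan (μ : FinDist Tm) (a : Chan) : Prop := ∃ P, μ.toFun P ≠ 0 ∧ a ∈ P.chans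

end FinDist

/-! ## Part I: the probabilistic labelled transition system on processes -/

/-- Part I of the pLTS for RCCS (and RCCS^ω): `P →α ρ`. -/
inductive Step : Tm → Act → FinDist Tm → Prop where
  | choice {k : ℕ} (acts : Fin (k+1) → Act) (conts : Fin (k+1) → Tm) (i : Fin (k+1)) :
      Step (.sum k acts conts) (acts i) (FinDist.dirac (conts i))
  | oplus {k : ℕ} (w : Fin (k+1) → ℝ) (conts : Fin (k+1) → Tm) (ρ : FinDist Tm) :
      (∀ i, 0 < w i ∧ w i < 1) →
      (∀ Q, ρ.toFun Q = ∑ i, if conts i = Q then w i else 0) →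
      Step (.oplus k w conts) .tau ρ
  | parL {S : Tm} {α : Act} {ρ : FinDist Tm} (T : Tm) :
      Step S α ρ → Step (.par S T) α (ρ.parD (FinDist.dirac T))
  | parR {T : Tm} {α : Act} {ρ : FinDist Tm} (S : Tm) :
      Step T α ρ → Step (.par S T) α ((FinDist.dirac S).parD ρ)
  | comm {S T : Tm} {ℓ1 ℓ2 : Act} {ρ1 ρ2 : FinDist Tm} :
      Act.Comp ℓ1 ℓ2 → Step S ℓ1 ρ1 → Step T ℓ2 ρ2 →
      Step (.par S T) .tau (ρ1.parD ρ2)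
  | loc {T : Tm} {β : Act} {ρ : FinDist Tm} (L : Finset Chan) :
      Step T β ρ → Act.Allowed L β → Step (.loc L T) β (FinDist.locD L ρ)
  | fixp {T : Tm} {β : Act} {ρ : FinDist Tm} :
      Step (Tm.subst (.fix T) 0 T) β ρ → Step (.fix T) β ρ

/-! ## Part II: probabilistic transitions on distributions -/

/-- Part II of the pLTS: `μ →(α,p) ν` iff `0 < p ≤ 1` and there are `P ∈ supp μ`
and `ρ` with `P →α ρ` and `ν = μ + μ(P)·p·(ρ − δ_P)`. -/
def PStep (μ : FinDist Tm) (α : Act) (p : ℝ) (ν : FinDist Tm) : Prop :=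
  0 < p ∧ p ≤ 1 ∧
    ∃ P ρ, 0 < μ.toFun P ∧ Step P α ρ ∧
      ∀ Q, ν.toFun Q = μ.toFun Q + μ.toFun P * p * (ρ.toFun Q - (if Q = P then 1 else 0))

/-- Probabilistic transition sequence `μ →π ν` along a word `π`. -/
def PSeq : FinDist Tm → List (Act × ℝ) → FinDist Tm → Prop
  | μ, [], ν => ν = μ
  | μ, s :: π, ν => ∃ μ', PStep μ s.1 s.2 μ' ∧ PSeq μ' π ν

/-- Internal transition sequence `μ ⇝ ν`. -/
def Internal (μ ν : FinDist Tm) : Prop :=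
  ∃ π : List (Act × ℝ), (∀ s ∈ π, s.1 = Act.tau) ∧ PSeq μ π ν

/-! ## Observability predicates and testing characteristics -/

/-- `ψ_𝓛`: processes that can immediately perform an external action. -/
def psiL : Set Tm := {P | ∃ α ρ, Act.IsLabel α ∧ Step P α ρ}

/-- `ψ_ω`: processes that can immediately perform the success action `ω`. -/
def psiOmega : Set Tm := {P | ∃ ρ, Step P Act.omega ρ}

/-- The may characteristic `χmay_𝓛(μ) = sup { ν(ψ_𝓛) : μ ⇝ ν }`. -/
noncomputable def chiMayL (μ : FinDist Tm) : ℝ :=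
  sSup {x | ∃ ν, Internal μ ν ∧ x = ν.mass psiL}

/-- The fair characteristic `χfair_𝓛(μ) = inf { χmay_𝓛(ν) : μ ⇝ ν }`. -/
noncomputable def chiFairL (μ : FinDist Tm) : ℝ :=
  sInf {x | ∃ ν, Internal μ ν ∧ x = chiMayL ν}

/-- `χmay_ω(μ) = sup { ν(ψ_ω) : μ ⇝ ν }`. -/
noncomputable def chiMayOmega (μ : FinDist Tm) : ℝ :=
  sSup {x | ∃ ν, Internal μ ν ∧ x = ν.mass psiOmega}

/-- `χfair_ω(μ) = inf { χmay_ω(ν) : μ ⇝ ν }`. -/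
noncomputable def chiFairOmega (μ : FinDist Tm) : ℝ :=
  sInf {x | ∃ ν, Internal μ ν ∧ x = chiMayOmega ν}

/-! ## Testing contexts, equipollence, extensionality, diamond/box equivalences -/

/-- `Δ(P_CCS) ⊆ 𝒟 ⊆ D(P_RCCS)`, closed under parallel composition, localization
and (finite-domain) renaming. -/
structure IsTestingContext (D : Set (FinDist Tm)) : Prop where
  dirac_ccs : ∀ P : Tm, P.IsCCS → FinDist.dirac P ∈ D
  proc_dist : ∀ μ ∈ D, μ.IsProcDist
  closed_par : ∀ μ ∈ D, ∀ ν ∈ D, μ.parD ν ∈ D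
  closed_loc : ∀ μ ∈ D, ∀ L : Finset Chan, FinDist.locD L μ ∈ D
  closed_rename : ∀ μ ∈ D, ∀ f : Chan → Chan, {a | f a ≠ a}.Finite →
      FinDist.renameD f μ ∈ D

/-- `R` is probabilistically equipollent. -/
def Equipollent (R : FinDist Tm → FinDist Tm → Prop) : Prop :=
  ∀ μ1 μ2, R μ1 μ2 → chiMayL μ1 = chiMayL μ2

/-- `R` is probabilistically strongly equipollent. -/
def StronglyEquipollent (R : FinDist Tm → FinDist Tm → Prop) : Prop :=
  ∀ μ1 μ2, R μ1 μ2 → chiFairL μ1 = chiFairL μ2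

/-- `R` is `𝒟`-extensional. -/
def DExtensional (D : Set (FinDist Tm)) (R : FinDist Tm → FinDist Tm → Prop) : Prop :=
  ∀ μ1 μ2, R μ1 μ2 →
    (∀ ν ∈ D, R (μ1.parD ν) (μ2.parD ν)) ∧
    (∀ L : Finset Chan, R (FinDist.locD L μ1) (FinDist.locD L μ2))

/-- The `𝒟`-diamond equivalence `=◇^𝒟`, the largest probabilistically equipollent
`𝒟`-extensional relation. -/
def DiamondEq (D : Set (FinDist Tm)) (μ1 μ2 : FinDist Tm) : Prop :=
  ∃ R, Equipollent R ∧ DExtensional D R ∧ R μ1 μ2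

/-- The `𝒟`-box equivalence `=□^𝒟`, the largest probabilistically strongly
equipollent `𝒟`-extensional relation. -/
def BoxEq (D : Set (FinDist Tm)) (μ1 μ2 : FinDist Tm) : Prop :=
  ∃ R, StronglyEquipollent R ∧ DExtensional D R ∧ R μ1 μ2

/-! ## Probabilistic strong bisimulation and lifting -/

/-- Lifting of a relation on processes to distributions, matching the decomposition
`ρ1 = Σ_i p_i δ_{A_i}`, `ρ2 = Σ_i p_i δ_{B_i}` with `A_i R B_i`. -/
def RelLift (R : Tm → Tm → Prop) (ρ1 ρ2 : FinDist Tm) : Prop :=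
  ∃ (k : ℕ) (p : Fin (k+1) → ℝ) (A B : Fin (k+1) → Tm),
    (∀ i, 0 ≤ p i) ∧
    (∀ Q, ρ1.toFun Q = ∑ i, if A i = Q then p i else 0) ∧
    (∀ Q, ρ2.toFun Q = ∑ i, if B i = Q then p i else 0) ∧
    (∀ i, R (A i) (B i))

/-- `R` is a probabilistic strong bisimulation. -/
def IsStrongBisim (R : Tm → Tm → Prop) : Prop :=
  ∀ P Q, R P Q →
    (∀ α ρ, Step P α ρ → ∃ ρ', Step Q α ρ' ∧ RelLift R ρ ρ') ∧
    (∀ α ρ, Step Q α ρ → ∃ ρ', Step P α ρ' ∧ RelLift R ρ ρ')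

/-- `∼p`, the largest probabilistic strong bisimulation. -/
def StrongBisim (P Q : Tm) : Prop := ∃ R, IsStrongBisim R ∧ R P Q

/-- Lifting `E†` of an equivalence on processes to distributions: agreement on the
mass of every equivalence class. -/
def EqLift (E : Tm → Tm → Prop) (μ1 μ2 : FinDist Tm) : Prop :=
  ∀ P, μ1.mass {Q | E P Q} = μ2.mass {Q | E P Q}

/-- The `𝒟`-extensional closure `R^𝒟 = ⋃_k R_k` of a relation `R` on distributions:
`R_0 = R` and `R_{k+1} = { ((L)μ1 | ν, (L)μ2 | ν) : μ1 R_k μ2, ν ∈ 𝒟, L finite }`. -/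
inductive ExtClosure (D : Set (FinDist Tm)) (R : FinDist Tm → FinDist Tm → Prop) :
    FinDist Tm → FinDist Tm → Prop where
  | base {μ1 μ2 : FinDist Tm} : R μ1 μ2 → ExtClosure D R μ1 μ2
  | step {μ1 μ2 : FinDist Tm} (ν : FinDist Tm) (hν : ν ∈ D) (L : Finset Chan) :
      ExtClosure D R μ1 μ2 →
      ExtClosure D R ((FinDist.locD L μ1).parD ν) ((FinDist.locD L μ2).parD ν)

/-- A 1-ary distribution: a finitely supported distribution over RCCS terms with at
most one free variable `X`. -/
def Is1aryDist (ϑ : FinDist Tm) : Prop :=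
  ∀ T, ϑ.toFun T ≠ 0 → Tm.ClosedAt 1 T ∧ T.NoOmega

/-! ## Expectations -/

namespace FinDist

theorem ext_fun {α : Type} {μ ν : FinDist α} (h : ∀ a, μ.toFun a = ν.toFun a) : μ = ν := by
  cases μ; cases ν
  congr
  exact funext h

/-- Expectation of a real function. -/
noncomputable def ex {α : Type} (μ : FinDist α) (f : α → ℝ) : ℝ := ∑ᶠ a, μ.toFun a * f a

/-- The support as a finset. -/
noncomputable def supp {α : Type} (μ : FinDist α) : Finset α := μ.finite_support.toFinset

theorem mem_supp {α : Type} {μ : FinDist α} {a : α} : a ∈ μ.supp ↔ μ.toFun a ≠ 0 := by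
  simp [supp]

theorem ex_eq_sum_of {α : Type} (μ : FinDist α) (f : α → ℝ) (s : Finset α)
    (hs : ∀ a, μ.toFun a ≠ 0 → a ∈ s) : μ.ex f = ∑ a ∈ s, μ.toFun a * f a := by
  unfold ex
  apply finsum_eq_finset_sum_of_support_subset
  intro a ha
  exact hs a (left_ne_zero_of_mul ha)

theorem ex_eq_sum {α : Type} (μ : FinDist α) (f : α → ℝ) :
    μ.ex f = ∑ a ∈ μ.supp, μ.toFun a * f a :=
  ex_eq_sum_of μ f _ fun _ h => mem_supp.2 h

theorem mass_eq_ex {α : Type} (μ : FinDist α) (φ : Set α) :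
    μ.mass φ = μ.ex (fun a => if a ∈ φ then 1 else 0) := by
  unfold mass ex
  rw [finsum_mem_def]
  apply finsum_congr
  intro a
  by_cases h : a ∈ φ <;> simp [h]

theorem toFun_eq_ex {α : Type} (μ : FinDist α) (b : α) :
    μ.toFun b = μ.ex (fun a => if a = b then 1 else 0) := by
  unfold ex
  rw [finsum_eq_single _ b (fun a ha => by simp [ha])]
  simp

theorem ex_one {α : Type} (μ : FinDist α) : μ.ex (fun _ => 1) = 1 := by
  unfold ex
  simpa using μ.sum_one

theorem ext_ex {α : Type} {μ ν : FinDist α} (h : ∀ f, μ.ex f = ν.ex f) : μ = ν := by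
  apply ext_fun
  intro a
  rw [toFun_eq_ex, toFun_eq_ex, h]

theorem ex_dirac {α : Type} (a : α) (f : α → ℝ) : (dirac a).ex f = f a := by
  unfold ex dirac
  rw [finsum_eq_single _ a (fun b hb => by simp [hb])]
  simp

theorem ex_map {α β : Type} (g : α → β) (μ : FinDist α) (f : β → ℝ) :
    (μ.map g).ex f = μ.ex (fun a => f (g a)) := by
  have h1 : ∀ b, (μ.map g).toFun b = ∑ a ∈ μ.supp, μ.toFun a * if g a = b then 1 else 0 := by
    intro b
    have : (μ.map g).toFun b = μ.mass {a | g a = b} := rfl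
    rw [this, mass_eq_ex, ex_eq_sum]
    rfl
  rw [ex_eq_sum_of (μ.map g) f (μ.supp.image g), ex_eq_sum]
  · simp_rw [h1, Finset.sum_mul]
    rw [Finset.sum_comm]
    apply Finset.sum_congr rfl
    intro a ha
    rw [Finset.sum_eq_single (g a)]
    · simp
    · intro b _ hb
      simp [hb.symm]
    · intro h
      exact absurd (Finset.mem_image_of_mem g ha) h
  · intro b hb
    rw [h1] at hb
    obtain ⟨a, ha, hne⟩ := Finset.exists_ne_zero_of_sum_ne_zero hb
    have : g a = b := by
      by_contra h
      simp [h] at hne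
    exact Finset.mem_image.2 ⟨a, ha, this⟩

theorem ex_prod {α β : Type} (μ : FinDist α) (ν : FinDist β) (f : α × β → ℝ) :
    (μ.prod ν).ex f = μ.ex (fun a => ν.ex (fun b => f (a, b))) := by
  rw [ex_eq_sum_of (μ.prod ν) f (μ.supp ×ˢ ν.supp), ex_eq_sum, Finset.sum_product]
  · apply Finset.sum_congr rfl
    intro a _
    rw [ex_eq_sum, Finset.mul_sum]
    apply Finset.sum_congr rfl
    intro b _
    simp only [prod]
    ring
  · intro x hx
    have h := mul_ne_zero_iff.mp hx
    rw [Finset.mem_product, mem_supp, mem_supp]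
    exact h

theorem ex_parD (μ ν : FinDist Tm) (f : Tm → ℝ) :
    (μ.parD ν).ex f = μ.ex (fun a => ν.ex (fun b => f (.par a b))) := by
  unfold parD
  rw [ex_map, ex_prod]

theorem ex_locD (L : Finset Chan) (μ : FinDist Tm) (f : Tm → ℝ) :
    (locD L μ).ex f = μ.ex (fun a => f (.loc L a)) := ex_map _ _ _

theorem ex_instD (ϑ : FinDist Tm) (P : Tm) (f : Tm → ℝ) :
    (ϑ.instD P).ex f = ϑ.ex (fun a => f (Tm.subst P 0 a)) := ex_map _ _ _

theorem ex_congr {α : Type} (μ : FinDist α) {f g : α → ℝ}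
    (h : ∀ a, μ.toFun a ≠ 0 → f a = g a) : μ.ex f = μ.ex g := by
  unfold ex
  apply finsum_congr
  intro a
  by_cases ha : μ.toFun a = 0
  · simp [ha]
  · rw [h a ha]

theorem toFun_le_mass {α : Type} (μ : FinDist α) (φ : Set α) (a : α) (ha : a ∈ φ) :
    μ.toFun a ≤ μ.mass φ := by
  rw [mass_eq_ex, ex_eq_sum]
  by_cases h : a ∈ μ.supp
  · refine le_trans ?_ (Finset.single_le_sum
      (f := fun a => μ.toFun a * if a ∈ φ then (1:ℝ) else 0) ?_ h)
    · simp [ha]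
    · intro i _
      by_cases hi : i ∈ φ <;> simp [hi, μ.nonneg]
  · have : μ.toFun a = 0 := by simpa [mem_supp] using h
    rw [this]
    apply Finset.sum_nonneg
    intro i _
    by_cases hi : i ∈ φ <;> simp [hi, μ.nonneg]

end FinDist

open FinDist

/-- Lifting through invariant functions. -/
def ILift (R : Tm → Tm → Prop) (μ ν : FinDist Tm) : Prop :=
  ∀ f : Tm → ℝ, (∀ a b, R a b → f a = f b) → μ.ex f = ν.ex f

theorem ILift.mono {R S : Tm → Tm → Prop} (h : ∀ a b, R a b → S a b) {μ ν : FinDist Tm}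
    (hl : ILift R μ ν) : ILift S μ ν :=
  fun f hf => hl f fun a b hab => hf a b (h a b hab)

theorem RelLift.ilift {R : Tm → Tm → Prop} {μ ν : FinDist Tm} (h : RelLift R μ ν) :
    ILift R μ ν := by
  obtain ⟨k, p, A, B, _, hA, hB, hR⟩ := h
  intro f hf
  have key : ∀ (ρ : FinDist Tm) (C : Fin (k+1) → Tm),
      (∀ Q, ρ.toFun Q = ∑ i, if C i = Q then p i else 0) → ρ.ex f = ∑ i, p i * f (C i) := by
    intro ρ C hC
    rw [ex_eq_sum_of ρ f (Finset.univ.image C)]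
    · simp_rw [hC, Finset.sum_mul]
      rw [Finset.sum_comm]
      apply Finset.sum_congr rfl
      intro i _
      rw [Finset.sum_eq_single (C i)]
      · simp
      · intro b _ hb
        simp [hb.symm]
      · intro h
        exact absurd (Finset.mem_image_of_mem C (Finset.mem_univ i)) h
    · intro Q hQ
      rw [hC] at hQ
      obtain ⟨i, _, hne⟩ := Finset.exists_ne_zero_of_sum_ne_zero hQ
      have : C i = Q := by
        by_contra h
        simp [h] at hne
      exact Finset.mem_image.2 ⟨i, Finset.mem_univ _, this⟩
  rw [key μ A hA, key ν B hB]
  exact Finset.sum_congr rfl fun i _ => by rw [hf _ _ (hR i)]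

theorem ILift.eqLift {E : Tm → Tm → Prop} (hE : Equivalence E) {μ ν : FinDist Tm}
    (h : ILift E μ ν) : EqLift E μ ν := by
  intro P
  rw [mass_eq_ex, mass_eq_ex]
  apply h
  intro a b hab
  have : E P a ↔ E P b := ⟨fun h => hE.trans h hab, fun h => hE.trans h (hE.symm hab)⟩
  simp [this]

theorem EqLift.ilift {E : Tm → Tm → Prop} (hE : Equivalence E) {μ ν : FinDist Tm}
    (h : EqLift E μ ν) : ILift E μ ν := by
  intro f hf
  let st : Setoid Tm := ⟨E, hE⟩
  let q : Tm → Quotient st := fun a => Quotient.mk st a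
  let F : Quotient st → ℝ := Quotient.lift f hf
  have hmap : μ.map q = ν.map q := by
    apply ext_fun
    intro c
    induction c using Quotient.inductionOn with
    | h P =>
      have hs : {a | q a = Quotient.mk st P} = {a | E P a} := by
        ext a
        simp only [Set.mem_setOf_eq, q]
        rw [Quotient.eq]
        exact ⟨fun h => hE.symm h, fun h => hE.symm h⟩
      change μ.mass {a | q a = Quotient.mk st P} = ν.mass {a | q a = Quotient.mk st P}
      rw [hs]
      exact h P
  have h1 := ex_map q μ F
  have h2 := ex_map q ν F
  rw [hmap] at h1
  exact h1.symm.trans h2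

theorem EqLift.relLift {E : Tm → Tm → Prop} (hE : Equivalence E) {μ ν : FinDist Tm}
    (h : EqLift E μ ν) : RelLift E μ ν := by
  set m : Tm → ℝ := fun a => μ.mass {b | E a b} with hm
  have hmE : ∀ a b, E a b → m a = m b := by
    intro a b hab
    have : {c | E a c} = {c | E b c} := by
      ext c
      exact ⟨fun h => hE.trans (hE.symm hab) h, fun h => hE.trans hab h⟩
    simp only [hm, this]
  have hm1 : ∀ a, m a = ∑ b ∈ μ.supp, if E a b then μ.toFun b else 0 := by
    intro a
    simp only [hm]
    rw [mass_eq_ex, ex_eq_sum]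
    apply Finset.sum_congr rfl
    intro b _
    simp
  have hm2 : ∀ a, m a = ∑ b ∈ ν.supp, if E a b then ν.toFun b else 0 := by
    intro a
    simp only [hm]
    rw [h a, mass_eq_ex, ex_eq_sum]
    apply Finset.sum_congr rfl
    intro b _
    simp
  have hle1 : ∀ a, μ.toFun a ≤ m a := fun a => toFun_le_mass _ _ _ (hE.refl a)
  have hle2 : ∀ a, ν.toFun a ≤ m a := fun a => by
    simp only [hm]; rw [h a]; exact toFun_le_mass _ _ _ (hE.refl a)
  set t : Finset (Tm × Tm) := (μ.supp ×ˢ ν.supp).filter (fun x => E x.1 x.2) with ht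
  let w : Tm × Tm → ℝ := fun x => μ.toFun x.1 * ν.toFun x.2 / m x.1
  have hmarg1 : ∀ Q, μ.toFun Q = ∑ x ∈ t, if x.1 = Q then w x else 0 := by
    intro Q
    rw [ht, Finset.sum_filter, Finset.sum_product]
    by_cases hQ : Q ∈ μ.supp
    · rw [Finset.sum_eq_single Q]
      · have hpos : 0 < m Q :=
          lt_of_lt_of_le (lt_of_le_of_ne (μ.nonneg Q) (mem_supp.1 hQ).symm) (hle1 Q)
        have : ∀ b, (if E Q b then (if Q = Q then w (Q, b) else 0) else 0)
            = μ.toFun Q / m Q * (if E Q b then ν.toFun b else 0) := by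
          intro b
          by_cases hb : E Q b
          · simp only [hb, if_true, w]; ring
          · simp [hb]
        refine Eq.trans ?_ (Finset.sum_congr rfl (fun b _ => (this b).symm))
        rw [← Finset.mul_sum, ← hm2]
        field_simp
      · intro b _ hb
        simp [hb]
      · intro h; exact absurd hQ h
    · have h0 : μ.toFun Q = 0 := by simpa [mem_supp] using hQ
      rw [h0]
      symm
      apply Finset.sum_eq_zero
      intro a ha
      apply Finset.sum_eq_zero
      intro b _
      have : a ≠ Q := fun h => hQ (h ▸ ha)
      simp [this]
  have hmarg2 : ∀ Q, ν.toFun Q = ∑ x ∈ t, if x.2 = Q then w x else 0 := by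
    intro Q
    rw [ht, Finset.sum_filter, Finset.sum_product_right]
    by_cases hQ : Q ∈ ν.supp
    · rw [Finset.sum_eq_single Q]
      · have hpos : 0 < m Q :=
          lt_of_lt_of_le (lt_of_le_of_ne (ν.nonneg Q) (mem_supp.1 hQ).symm) (hle2 Q)
        have : ∀ b, (if E b Q then (if Q = Q then w (b, Q) else 0) else 0)
            = ν.toFun Q / m Q * (if E Q b then μ.toFun b else 0) := by
          intro b
          by_cases hb : E b Q
          · have hb' := hE.symm hb
            simp only [hb, hb', if_true, w]
            rw [hmE b Q hb]; ring
          · have hb' : ¬ E Q b := fun h => hb (hE.symm h)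
            simp [hb, hb']
        refine Eq.trans ?_ (Finset.sum_congr rfl (fun b _ => (this b).symm))
        rw [← Finset.mul_sum, ← hm1]
        field_simp
      · intro b _ hb
        simp [hb]
      · intro h; exact absurd hQ h
    · have h0 : ν.toFun Q = 0 := by simpa [mem_supp] using hQ
      rw [h0]
      symm
      apply Finset.sum_eq_zero
      intro a ha
      apply Finset.sum_eq_zero
      intro b _
      have : a ≠ Q := fun h => hQ (h ▸ ha)
      simp [this]
  have htne : t.Nonempty := by
    rw [Finset.nonempty_iff_ne_empty]
    intro h0
    have : ∀ Q, μ.toFun Q = 0 := fun Q => by rw [hmarg1 Q, h0]; simp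
    have h1 := μ.sum_one
    simp [this] at h1
  obtain ⟨k, hk⟩ : ∃ k, t.card = k + 1 :=
    ⟨t.card - 1, by have := htne.card_pos; omega⟩
  let e : t ≃ Fin (k+1) := t.equivFinOfCardEq hk
  have hsum : ∀ g : Tm × Tm → ℝ, ∑ x ∈ t, g x = ∑ i, g (e.symm i).1 := by
    intro g
    rw [← Finset.sum_coe_sort t g]
    exact (Equiv.sum_comp e.symm (fun x => g x.1)).symm
  refine ⟨k, fun i => w (e.symm i).1, fun i => (e.symm i).1.1, fun i => (e.symm i).1.2,
    ?_, ?_, ?_, ?_⟩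
  · intro i
    exact div_nonneg (mul_nonneg (μ.nonneg _) (ν.nonneg _)) ((μ.nonneg _).trans (hle1 _))
  · intro Q
    rw [hmarg1 Q, hsum]
  · intro Q
    rw [hmarg2 Q, hsum]
  · intro i
    exact (Finset.mem_filter.1 (e.symm i).2).2

/-! ## Strong bisimilarity -/

/-- Coinduction principle: bisimulation up to equivalence generation. -/
theorem strongBisim_of {R : Tm → Tm → Prop}
    (h : ∀ P Q, R P Q →
      (∀ α ρ, Step P α ρ → ∃ ρ', Step Q α ρ' ∧ ILift R ρ ρ') ∧
      (∀ α ρ', Step Q α ρ' → ∃ ρ, Step P α ρ ∧ ILift R ρ ρ'))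
    {P Q : Tm} (hPQ : R P Q) : StrongBisim P Q := by
  have hEq : Equivalence (Relation.EqvGen R) := Relation.EqvGen.is_equivalence R
  have hsub : ∀ a b, R a b → Relation.EqvGen R a b := fun a b h => .rel a b h
  have main : ∀ P Q, Relation.EqvGen R P Q →
      (∀ α ρ, Step P α ρ → ∃ ρ', Step Q α ρ' ∧ EqLift (Relation.EqvGen R) ρ ρ') ∧
      (∀ α ρ, Step Q α ρ → ∃ ρ', Step P α ρ' ∧ EqLift (Relation.EqvGen R) ρ ρ') := by
    intro P Q hPQ
    induction hPQ with
    | rel P Q hr =>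
      obtain ⟨h1, h2⟩ := h P Q hr
      refine ⟨fun α ρ hs => ?_, fun α ρ hs => ?_⟩
      · obtain ⟨ρ', hs', hl⟩ := h1 α ρ hs
        exact ⟨ρ', hs', (hl.mono hsub).eqLift hEq⟩
      · obtain ⟨ρ', hs', hl⟩ := h2 α ρ hs
        exact ⟨ρ', hs', fun X => ((hl.mono hsub).eqLift hEq X).symm⟩
    | refl P => exact ⟨fun α ρ hs => ⟨ρ, hs, fun _ => rfl⟩, fun α ρ hs => ⟨ρ, hs, fun _ => rfl⟩⟩
    | symm P Q _ ih => exact ⟨ih.2, ih.1⟩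
    | trans P Q S _ _ ih1 ih2 =>
      refine ⟨fun α ρ hs => ?_, fun α ρ hs => ?_⟩
      · obtain ⟨ρ', hs', hl⟩ := ih1.1 α ρ hs
        obtain ⟨ρ'', hs'', hl'⟩ := ih2.1 α ρ' hs'
        exact ⟨ρ'', hs'', fun X => (hl X).trans (hl' X)⟩
      · obtain ⟨ρ', hs', hl⟩ := ih2.2 α ρ hs
        obtain ⟨ρ'', hs'', hl'⟩ := ih1.2 α ρ' hs'
        exact ⟨ρ'', hs'', fun X => (hl X).trans (hl' X)⟩
  refine ⟨Relation.EqvGen R, ?_, hsub _ _ hPQ⟩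
  intro P Q hPQ
  obtain ⟨h1, h2⟩ := main P Q hPQ
  refine ⟨fun α ρ hs => ?_, fun α ρ hs => ?_⟩
  · obtain ⟨ρ', hs', hl⟩ := h1 α ρ hs
    exact ⟨ρ', hs', hl.relLift hEq⟩
  · obtain ⟨ρ', hs', hl⟩ := h2 α ρ hs
    exact ⟨ρ', hs', hl.relLift hEq⟩

theorem ILift.symm {R : Tm → Tm → Prop} {μ ν : FinDist Tm} (h : ILift R μ ν) : ILift R ν μ :=
  fun f hf => (h f hf).symm

theorem StrongBisim.unfold {P Q : Tm} (h : StrongBisim P Q) :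
    (∀ α ρ, Step P α ρ → ∃ ρ', Step Q α ρ' ∧ ILift StrongBisim ρ ρ') ∧
    (∀ α ρ', Step Q α ρ' → ∃ ρ, Step P α ρ ∧ ILift StrongBisim ρ ρ') := by
  obtain ⟨R, hR, hPQ⟩ := h
  have hsub : ∀ a b, R a b → StrongBisim a b := fun a b h => ⟨R, hR, h⟩
  obtain ⟨h1, h2⟩ := hR P Q hPQ
  refine ⟨fun α ρ hs => ?_, fun α ρ hs => ?_⟩
  · obtain ⟨ρ', hs', hl⟩ := h1 α ρ hs
    exact ⟨ρ', hs', hl.ilift.mono hsub⟩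
  · obtain ⟨ρ', hs', hl⟩ := h2 α ρ hs
    exact ⟨ρ', hs', (hl.ilift.mono hsub).symm⟩

theorem strongBisim_refl (P : Tm) : StrongBisim P P := by
  refine strongBisim_of (R := Eq) ?_ rfl
  rintro P Q rfl
  exact ⟨fun α ρ hs => ⟨ρ, hs, fun _ _ => rfl⟩, fun α ρ hs => ⟨ρ, hs, fun _ _ => rfl⟩⟩

theorem StrongBisim.symm {P Q : Tm} (h : StrongBisim P Q) : StrongBisim Q P := by
  refine strongBisim_of (R := fun a b => StrongBisim b a) ?_ h
  intro P Q h
  have hm : ∀ ρ ρ', ILift StrongBisim ρ ρ' → ILift (fun a b => StrongBisim b a) ρ ρ' :=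
    fun ρ ρ' hl f hf => hl f fun a b hab => (hf b a hab).symm
  obtain ⟨h1, h2⟩ := h.unfold
  refine ⟨fun α ρ hs => ?_, fun α ρ hs => ?_⟩
  · obtain ⟨ρ', hs', hl⟩ := h2 α ρ hs
    exact ⟨ρ', hs', (hm _ _ hl).symm⟩
  · obtain ⟨ρ', hs', hl⟩ := h1 α ρ hs
    exact ⟨ρ', hs', (hm _ _ hl).symm⟩

theorem StrongBisim.trans {P Q S : Tm} (h : StrongBisim P Q) (h' : StrongBisim Q S) :
    StrongBisim P S := by
  refine strongBisim_of (R := fun a b => ∃ c, StrongBisim a c ∧ StrongBisim c b) ?_ ⟨Q, h, h'⟩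
  rintro P S ⟨Q, h, h'⟩
  have hm : ∀ ρ ρ', ILift StrongBisim ρ ρ' →
      ILift (fun a b => ∃ c, StrongBisim a c ∧ StrongBisim c b) ρ ρ' :=
    fun ρ ρ' hl => hl.mono fun a b hab => ⟨b, hab, strongBisim_refl b⟩
  refine ⟨fun α ρ hs => ?_, fun α ρ hs => ?_⟩
  · obtain ⟨ρ', hs', hl⟩ := h.unfold.1 α ρ hs
    obtain ⟨ρ'', hs'', hl'⟩ := h'.unfold.1 α ρ' hs'
    exact ⟨ρ'', hs'', fun f hf => (hm _ _ hl f hf).trans (hm _ _ hl' f hf)⟩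
  · obtain ⟨ρ', hs', hl⟩ := h'.unfold.2 α ρ hs
    obtain ⟨ρ'', hs'', hl'⟩ := h.unfold.2 α ρ' hs'
    exact ⟨ρ'', hs'', fun f hf => (hm _ _ hl' f hf).trans (hm _ _ hl f hf)⟩

theorem strongBisim_equiv : Equivalence StrongBisim :=
  ⟨strongBisim_refl, StrongBisim.symm, StrongBisim.trans⟩

theorem StrongBisim.par {P Q S T : Tm} (h : StrongBisim P Q) (h' : StrongBisim S T) :
    StrongBisim (.par P S) (.par Q T) := by
  let R : Tm → Tm → Prop := fun a b => ∃ P Q S T, StrongBisim P Q ∧ StrongBisim S T ∧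
    a = .par P S ∧ b = .par Q T
  have lift2 : ∀ ρ1 ρ1' ρ2 ρ2', ILift StrongBisim ρ1 ρ1' → ILift StrongBisim ρ2 ρ2' →
      ILift R (ρ1.parD ρ2) (ρ1'.parD ρ2') := by
    intro ρ1 ρ1' ρ2 ρ2' h1 h2 f hf
    rw [ex_parD, ex_parD, h1]
    · congr 1
      funext a
      apply h2
      intro b b' hb
      exact hf _ _ ⟨a, a, b, b', strongBisim_refl _, hb, rfl, rfl⟩
    · intro a a' ha
      congr 1
      funext b
      exact hf _ _ ⟨a, a', b, b, ha, strongBisim_refl _, rfl, rfl⟩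
  have ld : ∀ a b, StrongBisim a b → ILift StrongBisim (dirac a) (dirac b) := by
    intro a b hab f hf
    rw [ex_dirac, ex_dirac]
    exact hf _ _ hab
  have one : ∀ P Q S T, StrongBisim P Q → StrongBisim S T → ∀ α ρ, Step (.par P S) α ρ →
      ∃ ρ', Step (.par Q T) α ρ' ∧ ILift R ρ ρ' := by
    intro P Q S T h h' α ρ hs
    cases hs with
    | parL _ hs =>
      obtain ⟨ρ', hs', hl⟩ := h.unfold.1 _ _ hs
      exact ⟨_, .parL _ hs', lift2 _ _ _ _ hl (ld _ _ h')⟩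
    | parR _ hs =>
      obtain ⟨ρ', hs', hl⟩ := h'.unfold.1 _ _ hs
      exact ⟨_, .parR _ hs', lift2 _ _ _ _ (ld _ _ h) hl⟩
    | comm hc hs1 hs2 =>
      obtain ⟨ρ1', hs1', hl1⟩ := h.unfold.1 _ _ hs1
      obtain ⟨ρ2', hs2', hl2⟩ := h'.unfold.1 _ _ hs2
      exact ⟨_, .comm hc hs1' hs2', lift2 _ _ _ _ hl1 hl2⟩
  refine strongBisim_of (R := R) ?_ ⟨P, Q, S, T, h, h', rfl, rfl⟩
  rintro _ _ ⟨P, Q, S, T, h, h', rfl, rfl⟩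
  refine ⟨one P Q S T h h', fun α ρ hs => ?_⟩
  obtain ⟨ρ', hs', hl⟩ := one Q P T S h.symm h'.symm α ρ hs
  exact ⟨ρ', hs', hl.symm⟩

theorem StrongBisim.loc {P Q : Tm} (L : Finset Chan) (h : StrongBisim P Q) :
    StrongBisim (.loc L P) (.loc L Q) := by
  let R : Tm → Tm → Prop := fun a b => ∃ P Q, StrongBisim P Q ∧ a = .loc L P ∧ b = .loc L Q
  have one : ∀ P Q, StrongBisim P Q → ∀ α ρ, Step (.loc L P) α ρ →
      ∃ ρ', Step (.loc L Q) α ρ' ∧ ILift R ρ ρ' := by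
    intro P Q h α ρ hs
    cases hs with
    | loc _ hs ha =>
      obtain ⟨ρ', hs', hl⟩ := h.unfold.1 _ _ hs
      refine ⟨_, .loc L hs' ha, fun f hf => ?_⟩
      rw [ex_locD, ex_locD]
      apply hl
      intro a b hab
      exact hf _ _ ⟨a, b, hab, rfl, rfl⟩
  refine strongBisim_of (R := R) ?_ ⟨P, Q, h, rfl, rfl⟩
  rintro _ _ ⟨P, Q, h, rfl, rfl⟩
  refine ⟨one P Q h, fun α ρ hs => ?_⟩
  obtain ⟨ρ', hs', hl⟩ := one Q P h.symm α ρ hs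
  exact ⟨ρ', hs', hl.symm⟩

theorem strongBisim_par_nil (P : Tm) : StrongBisim (.par P .nil) P := by
  refine strongBisim_of (R := fun a b => a = .par b .nil) ?_ rfl
  rintro _ P rfl
  have hl : ∀ ρ : FinDist Tm,
      ILift (fun a b => a = Tm.par b .nil) (ρ.parD (dirac .nil)) ρ := by
    intro ρ f hf
    rw [ex_parD]
    apply ex_congr
    intro a _
    rw [ex_dirac]
    exact hf _ _ rfl
  refine ⟨fun α ρ hs => ?_, fun α ρ hs => ⟨_, .parL _ hs, hl ρ⟩⟩
  cases hs with
  | parL _ hs => exact ⟨_, hs, hl _⟩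
  | parR _ hs => cases hs
  | comm hc hs1 hs2 => cases hs2

theorem strongBisim_loc_empty (P : Tm) : StrongBisim (.loc ∅ P) P := by
  refine strongBisim_of (R := fun a b => a = .loc ∅ b) ?_ rfl
  rintro _ P rfl
  have hl : ∀ ρ : FinDist Tm, ILift (fun a b => a = Tm.loc ∅ b) (locD ∅ ρ) ρ := by
    intro ρ f hf
    rw [ex_locD]
    apply ex_congr
    intro a _
    exact hf _ _ rfl
  refine ⟨fun α ρ hs => ?_, fun α ρ hs => ⟨_, .loc _ hs ?_, hl ρ⟩⟩
  · cases hs with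
    | loc _ hs ha => exact ⟨_, hs, hl _⟩
  · cases α <;> simp [Act.Allowed]

/-! ## Distribution-level congruence -/

/-- Working form of the lifted bisimilarity. -/
abbrev DSim (μ ν : FinDist Tm) : Prop := ILift StrongBisim μ ν

theorem DSim.trans {μ ν ρ : FinDist Tm} (h : DSim μ ν) (h' : DSim ν ρ) : DSim μ ρ :=
  fun f hf => (h f hf).trans (h' f hf)

theorem DSim.refl (μ : FinDist Tm) : DSim μ μ := fun _ _ => rfl

theorem DSim.parD {μ1 μ2 : FinDist Tm} (h : DSim μ1 μ2) (ν : FinDist Tm) :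
    DSim (μ1.parD ν) (μ2.parD ν) := by
  intro f hf
  rw [ex_parD, ex_parD]
  apply h
  intro a b hab
  congr 1
  funext c
  exact hf _ _ (hab.par (strongBisim_refl c))

theorem DSim.locD {μ1 μ2 : FinDist Tm} (h : DSim μ1 μ2) (L : Finset Chan) :
    DSim (FinDist.locD L μ1) (FinDist.locD L μ2) := by
  intro f hf
  rw [ex_locD, ex_locD]
  apply h
  intro a b hab
  exact hf _ _ (hab.loc L)

theorem dsim_par_nil (μ : FinDist Tm) : DSim μ (μ.parD (dirac .nil)) := by
  intro f hf
  rw [ex_parD]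
  apply ex_congr
  intro a _
  rw [ex_dirac]
  exact hf _ _ (strongBisim_par_nil a).symm

theorem dsim_loc_empty (μ : FinDist Tm) : DSim μ (locD ∅ μ) := by
  intro f hf
  rw [ex_locD]
  apply ex_congr
  intro a _
  exact hf _ _ (strongBisim_loc_empty a).symm

/-! ## Simulating internal sequences -/

theorem Internal.refl (μ : FinDist Tm) : Internal μ μ := ⟨[], by simp, rfl⟩

theorem pseq_append {μ ν ρ : FinDist Tm} {π π' : List (Act × ℝ)} (h : PSeq μ π ν)
    (h' : PSeq ν π' ρ) : PSeq μ (π ++ π') ρ := by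
  induction π generalizing μ with
  | nil =>
    have : ν = μ := h
    subst this
    exact h'
  | cons s π ih =>
    obtain ⟨μ', hs, hr⟩ := h
    exact ⟨μ', hs, ih hr⟩

theorem Internal.trans {μ ν ρ : FinDist Tm} (h : Internal μ ν) (h' : Internal ν ρ) :
    Internal μ ρ := by
  obtain ⟨π, hπ, h⟩ := h
  obtain ⟨π', hπ', h'⟩ := h'
  refine ⟨π ++ π', ?_, pseq_append h h'⟩
  intro s hs
  rcases List.mem_append.1 hs with hs | hs
  · exact hπ s hs
  · exact hπ' s hs

theorem ex_of_toFun {ν ν' ρ : FinDist Tm} {Q : Tm} {w : ℝ}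
    (h : ∀ X, ν'.toFun X = ν.toFun X + w * (ρ.toFun X - (if X = Q then 1 else 0)))
    (f : Tm → ℝ) : ν'.ex f = ν.ex f + w * (ρ.ex f - f Q) := by
  set s : Finset Tm := ν.supp ∪ ρ.supp ∪ {Q} with hs
  have m1 : ∀ a, ν.toFun a ≠ 0 → a ∈ s := fun a ha => by simp [hs, mem_supp, ha]
  have m2 : ∀ a, ρ.toFun a ≠ 0 → a ∈ s := fun a ha => by simp [hs, mem_supp, ha]
  have m3 : Q ∈ s := by simp [hs]
  have m4 : ∀ a, ν'.toFun a ≠ 0 → a ∈ s := by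
    intro a ha
    by_contra hc
    have h1 : ν.toFun a = 0 := by by_contra h; exact hc (m1 a h)
    have h2 : ρ.toFun a = 0 := by by_contra h; exact hc (m2 a h)
    have h3 : a ≠ Q := fun h => hc (h ▸ m3)
    apply ha
    rw [h a, h1, h2]
    simp [h3]
  have hf : f Q = ∑ a ∈ s, (if a = Q then 1 else 0) * f a := by
    rw [Finset.sum_eq_single Q]
    · simp
    · intro b _ hb
      simp [hb]
    · intro h; exact absurd m3 h
  rw [ex_eq_sum_of ν' f s m4, ex_eq_sum_of ν f s m1, ex_eq_sum_of ρ f s m2, hf,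
    ← Finset.sum_sub_distrib, Finset.mul_sum, ← Finset.sum_add_distrib]
  apply Finset.sum_congr rfl
  intro a _
  rw [h a]
  ring

theorem exists_move (ν : FinDist Tm) (Q : Tm) (ρ : FinDist Tm) (w : ℝ) (hw : 0 < w)
    (hle : w ≤ ν.toFun Q) (hs : Step Q .tau ρ) :
    ∃ ν' : FinDist Tm, Internal ν ν' ∧
      (∀ X, ν'.toFun X = ν.toFun X + w * (ρ.toFun X - (if X = Q then 1 else 0))) := by
  let F : Tm → ℝ := fun X => ν.toFun X + w * (ρ.toFun X - (if X = Q then 1 else 0))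
  have hsub : Function.support F ⊆ ↑(ν.supp ∪ ρ.supp ∪ {Q}) := by
    intro a ha
    by_contra hc
    simp only [Finset.coe_union, Finset.coe_singleton, Set.mem_union, Finset.mem_coe,
      mem_supp, Set.mem_singleton_iff, not_or, not_not] at hc
    apply ha
    simp [F, hc]
  have hsum : ∑ᶠ a, F a = 1 := by
    rw [finsum_eq_finset_sum_of_support_subset _ hsub]
    have e1 := ν.ex_one
    have e2 := ρ.ex_one
    have e3 := (dirac Q).ex_one
    rw [ex_eq_sum_of _ _ (ν.supp ∪ ρ.supp ∪ {Q})] at e1 e2 e3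
    · simp only [mul_one] at e1 e2 e3
      have e3' : ∑ a ∈ ν.supp ∪ ρ.supp ∪ {Q}, (if a = Q then (1:ℝ) else 0) = 1 := e3
      simp only [F]
      rw [Finset.sum_add_distrib, ← Finset.mul_sum, Finset.sum_sub_distrib, e1, e2, e3']
      ring
    · intro a ha
      have : a = Q := by
        by_contra h
        simp [dirac, h] at ha
      simp [this]
    · intro a ha; simp [mem_supp, ha]
    · intro a ha; simp [mem_supp, ha]
  let ν' : FinDist Tm :=
    { toFun := F
      nonneg := by
        intro a
        have h1 := ν.nonneg a
        have h2 := mul_nonneg hw.le (ρ.nonneg a)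
        by_cases h : a = Q
        · simp only [F, h, if_true]
          rw [h] at h2
          linarith
        · simp only [F, h, if_false]
          linarith
      finite_support := (Finset.finite_toSet _).subset hsub
      sum_one := hsum }
  have hpos : 0 < ν.toFun Q := lt_of_lt_of_le hw hle
  refine ⟨ν', ⟨[(.tau, w / ν.toFun Q)], by simp, ν', ⟨div_pos hw hpos, ?_, Q, ρ, hpos, hs, ?_⟩,
    rfl⟩, fun X => rfl⟩
  · exact (div_le_one hpos).2 hle
  · intro X
    change F X = _
    have : ν.toFun Q * (w / ν.toFun Q) = w := by field_simp
    simp only [F]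
    rw [this]

theorem exists_moves (s : Finset Tm) (w : Tm → ℝ) (r : Tm → FinDist Tm) :
    ∀ ν : FinDist Tm, (∀ Q ∈ s, 0 < w Q ∧ w Q ≤ ν.toFun Q ∧ Step Q .tau (r Q)) →
    ∃ ν' : FinDist Tm, Internal ν ν' ∧
      ∀ f, ν'.ex f = ν.ex f + ∑ Q ∈ s, w Q * ((r Q).ex f - f Q) := by
  induction s using Finset.induction_on with
  | empty => intro ν _; exact ⟨ν, .refl ν, by simp⟩
  | insert Q s hQ ih =>
    intro ν h
    obtain ⟨h1, h2, h3⟩ := h Q (Finset.mem_insert_self _ _)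
    obtain ⟨ν1, hi, hf⟩ := exists_move ν Q (r Q) (w Q) h1 h2 h3
    obtain ⟨ν', hi', hf'⟩ := ih ν1 (by
      intro X hX
      obtain ⟨g1, g2, g3⟩ := h X (Finset.mem_insert_of_mem hX)
      refine ⟨g1, ?_, g3⟩
      have hne : X ≠ Q := fun h => hQ (h ▸ hX)
      rw [hf X]
      simp only [hne, if_false]
      have := mul_nonneg h1.le ((r Q).nonneg X)
      linarith)
    refine ⟨ν', hi.trans hi', fun f => ?_⟩
    rw [hf', ex_of_toFun hf, Finset.sum_insert hQ]
    ring

theorem DSim.pstep {μ ν μ' : FinDist Tm} (h : DSim μ ν) {p : ℝ} (hs : PStep μ .tau p μ') :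
    ∃ ν', Internal ν ν' ∧ DSim μ' ν' := by
  obtain ⟨hp0, hp1, P, ρ, hP, hst, hμ'⟩ := hs
  set m := ν.mass {Q | StrongBisim P Q} with hm
  have hmμ : μ.mass {Q | StrongBisim P Q} = m := h.eqLift strongBisim_equiv P
  have hPm : μ.toFun P ≤ m := by
    rw [← hmμ]
    exact toFun_le_mass _ _ _ (strongBisim_refl P)
  have hmpos : 0 < m := lt_of_lt_of_le hP hPm
  have hex : ∀ Q, ∃ ρ', StrongBisim P Q → Step Q .tau ρ' ∧ DSim ρ ρ' := by
    intro Q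
    by_cases hQ : StrongBisim P Q
    · obtain ⟨ρ', h1, h2⟩ := hQ.unfold.1 _ _ hst
      exact ⟨ρ', fun _ => ⟨h1, h2⟩⟩
    · exact ⟨ρ, fun h => absurd h hQ⟩
  choose r hr using hex
  set c := μ.toFun P * p / m with hc
  have hcpos : 0 < c := div_pos (mul_pos hP hp0) hmpos
  have hc1 : c ≤ 1 := by
    rw [hc, div_le_one hmpos]
    nlinarith
  set s := ν.supp.filter (fun Q => StrongBisim P Q) with hsdef
  obtain ⟨ν', hi, hf'⟩ := exists_moves s (fun Q => c * ν.toFun Q) r ν (by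
    intro Q hQ
    rw [hsdef, Finset.mem_filter, mem_supp] at hQ
    have hpos : 0 < ν.toFun Q := lt_of_le_of_ne (ν.nonneg Q) hQ.1.symm
    refine ⟨mul_pos hcpos hpos, ?_, (hr Q hQ.2).1⟩
    nlinarith)
  refine ⟨ν', hi, fun f hf => ?_⟩
  rw [hf' f, ex_of_toFun hμ' f, h f hf]
  have hms : m = ∑ Q ∈ s, ν.toFun Q := by
    rw [hm, mass_eq_ex, ex_eq_sum, hsdef, Finset.sum_filter]
    apply Finset.sum_congr rfl
    intro b _
    simp
  have : ∑ Q ∈ s, c * ν.toFun Q * ((r Q).ex f - f Q)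
      = ∑ Q ∈ s, ν.toFun Q * (c * (ρ.ex f - f P)) := by
    apply Finset.sum_congr rfl
    intro Q hQ
    rw [hsdef, Finset.mem_filter] at hQ
    rw [← (hr Q hQ.2).2 f hf, ← hf _ _ hQ.2]
    ring
  rw [this, ← Finset.sum_mul, ← hms, hc]
  field_simp

theorem DSim.internal {μ ν μ' : FinDist Tm} (h : DSim μ ν) (hi : Internal μ μ') :
    ∃ ν', Internal ν ν' ∧ DSim μ' ν' := by
  obtain ⟨π, hπ, hseq⟩ := hi
  induction π generalizing μ ν with
  | nil =>
    have : μ' = μ := hseq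
    subst this
    exact ⟨ν, .refl ν, h⟩
  | cons s π ih =>
    obtain ⟨μ1, hst, hrest⟩ := hseq
    have hs1 : s.1 = .tau := hπ s (by simp)
    rw [hs1] at hst
    obtain ⟨ν1, hi1, h1⟩ := h.pstep hst
    obtain ⟨ν', hi', h'⟩ := ih h1 (fun t ht => hπ t (by simp [ht])) hrest
    exact ⟨ν', hi1.trans hi', h'⟩

theorem DSim.mass_psiL {μ ν : FinDist Tm} (h : DSim μ ν) : μ.mass psiL = ν.mass psiL := by
  rw [mass_eq_ex, mass_eq_ex]
  apply h
  intro a b hab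
  have key : ∀ a b, StrongBisim a b → a ∈ psiL → b ∈ psiL := by
    rintro a b hab ⟨α, ρ, hα, hs⟩
    obtain ⟨ρ', hs', _⟩ := hab.unfold.1 _ _ hs
    exact ⟨α, ρ', hα, hs'⟩
  have : a ∈ psiL ↔ b ∈ psiL := ⟨key a b hab, key b a hab.symm⟩
  simp [this]

theorem DSim.chiMayL {μ ν : FinDist Tm} (h : DSim μ ν) : chiMayL μ = chiMayL ν := by
  unfold _root_.chiMayL
  congr 1
  ext x
  constructor
  · rintro ⟨μ', hi, rfl⟩
    obtain ⟨ν', hi', h'⟩ := h.internal hi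
    exact ⟨ν', hi', h'.mass_psiL⟩
  · rintro ⟨ν', hi, rfl⟩
    obtain ⟨μ', hi', h'⟩ := DSim.internal (ILift.symm h) hi
    exact ⟨μ', hi', DSim.mass_psiL h'⟩

theorem DSim.chiFairL {μ ν : FinDist Tm} (h : DSim μ ν) : chiFairL μ = chiFairL ν := by
  unfold _root_.chiFairL
  congr 1
  ext x
  constructor
  · rintro ⟨μ', hi, rfl⟩
    obtain ⟨ν', hi', h'⟩ := h.internal hi
    exact ⟨ν', hi', h'.chiMayL⟩
  · rintro ⟨ν', hi, rfl⟩
    obtain ⟨μ', hi', h'⟩ := DSim.internal (ILift.symm h) hi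
    exact ⟨μ', hi', DSim.chiMayL h'⟩

/-! ## The three criteria -/

theorem dsim_extensional (D : Set (FinDist Tm)) : DExtensional D DSim :=
  fun _ _ h => ⟨fun ν _ => h.parD ν, fun L => h.locD L⟩

/-- Extensional closure up to lifted bisimilarity. -/
def ExtUpTo (D : Set (FinDist Tm)) (R : FinDist Tm → FinDist Tm → Prop)
    (μ1 μ2 : FinDist Tm) : Prop :=
  ∃ μ1' μ2', ExtClosure D R μ1' μ2' ∧ DSim μ1 μ1' ∧ DSim μ2 μ2'

theorem extUpTo_extensional (D : Set (FinDist Tm)) (hD : IsTestingContext D)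
    (R : FinDist Tm → FinDist Tm → Prop) : DExtensional D (ExtUpTo D R) := by
  rintro μ1 μ2 ⟨μ1', μ2', hc, h1, h2⟩
  have hnil : dirac Tm.nil ∈ D :=
    hD.dirac_ccs _ ⟨⟨by simp [Tm.ClosedAt], by simp [Tm.NoOmega]⟩, by simp [Tm.NoOplus]⟩
  refine ⟨fun ν hν => ?_, fun L => ?_⟩
  · exact ⟨_, _, .step ν hν ∅ hc, (h1.trans (dsim_loc_empty _)).parD ν,
      (h2.trans (dsim_loc_empty _)).parD ν⟩
  · exact ⟨_, _, .step _ hnil L hc, (h1.locD L).trans (dsim_par_nil _),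
      (h2.locD L).trans (dsim_par_nil _)⟩

theorem closedAt_mono (T : Tm) : ∀ n, Tm.ClosedAt n T → Tm.ClosedAt (n+1) T := by
  induction T with
  | nil => intro n _; simp [Tm.ClosedAt]
  | var m => intro n h; simp only [Tm.ClosedAt] at *; omega
  | sum k a c ih => intro n h i; exact ih i n (h i)
  | oplus k w c ih => intro n h i; exact ih i n (h i)
  | par S T ih1 ih2 => intro n h; exact ⟨ih1 n h.1, ih2 n h.2⟩
  | loc L T ih => intro n h; exact ih n h
  | fix T ih => intro n h; exact ih (n+1) h

theorem subst_closed (P : Tm) (T : Tm) : ∀ n, Tm.ClosedAt n T → Tm.subst P n T = T := by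
  induction T with
  | nil => intro n _; simp [Tm.subst]
  | var m =>
    intro n h
    simp only [Tm.ClosedAt] at h
    simp [Tm.subst, Nat.ne_of_lt h]
  | sum k a c ih =>
    intro n h
    simp only [Tm.subst]
    congr 1
    funext i
    exact ih i n (h i)
  | oplus k w c ih =>
    intro n h
    simp only [Tm.subst]
    congr 1
    funext i
    exact ih i n (h i)
  | par S T ih1 ih2 => intro n h; simp only [Tm.subst]; rw [ih1 n h.1, ih2 n h.2]
  | loc L T ih => intro n h; simp only [Tm.subst]; rw [ih n h]
  | fix T ih => intro n h; simp only [Tm.subst]; rw [ih (n+1) h]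

theorem ne_zero_map {α β : Type} {g : α → β} {μ : FinDist α} {b : β}
    (h : (μ.map g).toFun b ≠ 0) : ∃ a, μ.toFun a ≠ 0 ∧ g a = b := by
  by_contra hc
  push Not at hc
  apply h
  apply finsum_mem_eq_zero_of_forall_eq_zero
  intro a ha
  by_contra h0
  exact hc a h0 ha

/-- Instances of a common 1-ary distribution. -/
def InstRel (P Q : Tm) (μ1 μ2 : FinDist Tm) : Prop :=
  ∃ ϑ : FinDist Tm, Is1aryDist ϑ ∧ μ1 = ϑ.instD P ∧ μ2 = ϑ.instD Q

theorem instD_parD {ϑ ν : FinDist Tm} (hν : ν.IsProcDist) (P : Tm) :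
    (ϑ.instD P).parD ν = (ϑ.parD ν).instD P := by
  apply ext_ex
  intro f
  rw [ex_parD, ex_instD, ex_instD, ex_parD]
  congr 1
  funext a
  apply ex_congr
  intro b hb
  simp only [Tm.subst]
  rw [subst_closed P b 0 (hν b hb).1]

theorem instD_locD (ϑ : FinDist Tm) (L : Finset Chan) (P : Tm) :
    locD L (ϑ.instD P) = (locD L ϑ).instD P := by
  apply ext_ex
  intro f
  rw [ex_locD, ex_instD, ex_instD, ex_locD]
  simp only [Tm.subst]

theorem instRel_extensional (D : Set (FinDist Tm)) (hD : IsTestingContext D) (P Q : Tm) :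
    DExtensional D (InstRel P Q) := by
  rintro _ _ ⟨ϑ, hϑ, rfl, rfl⟩
  refine ⟨fun ν hν => ⟨ϑ.parD ν, ?_, instD_parD (hD.proc_dist ν hν) P,
    instD_parD (hD.proc_dist ν hν) Q⟩, fun L => ⟨locD L ϑ, ?_, instD_locD ϑ L P,
    instD_locD ϑ L Q⟩⟩
  · intro T hT
    obtain ⟨⟨a, b⟩, hab, rfl⟩ := ne_zero_map hT
    have hab' := mul_ne_zero_iff.mp hab
    have ha := hϑ a hab'.1
    have hb := hD.proc_dist ν hν b hab'.2
    exact ⟨⟨ha.1, closedAt_mono b 0 hb.1⟩, ⟨ha.2, hb.2⟩⟩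
  · intro T hT
    obtain ⟨a, ha, rfl⟩ := ne_zero_map hT
    exact hϑ a ha

theorem instRel_dirac (P Q : Tm) : InstRel P Q (dirac P) (dirac Q) := by
  have h : ∀ P, dirac P = (dirac (Tm.var 0)).instD P := by
    intro P
    apply ext_ex
    intro f
    rw [ex_dirac, ex_instD, ex_dirac]
    simp [Tm.subst]
  refine ⟨dirac (.var 0), ?_, h P, h Q⟩
  intro T hT
  have : T = .var 0 := by
    by_contra hc
    simp [dirac, hc] at hT
  subst this
  exact ⟨by simp [Tm.ClosedAt], by simp [Tm.NoOmega]⟩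

/-- membership criteria for the diamond and box equivalences.
(1) `∼p†`-related distributions are `𝒟`-diamond and `𝒟`-box equivalent;
(2) if the `𝒟`-extensional closure of `R` is (strongly) equipollent then
    `R ⊆ =◇^𝒟` (resp. `R ⊆ =□^𝒟`);
(3) processes whose instantiations in every 1-ary distribution have equal may
    (resp. fair) characteristics are `𝒟`-diamond (resp. `𝒟`-box) equivalent. -/
theorem show_membership (D : Set (FinDist Tm)) (hD : IsTestingContext D) :
    (∀ μ1 μ2 : FinDist Tm, μ1.IsProcDist → μ2.IsProcDist →
      EqLift StrongBisim μ1 μ2 → DiamondEq D μ1 μ2 ∧ BoxEq D μ1 μ2) ∧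
    (∀ R : FinDist Tm → FinDist Tm → Prop,
      (Equipollent (ExtClosure D R) → ∀ μ1 μ2, R μ1 μ2 → DiamondEq D μ1 μ2) ∧
      (StronglyEquipollent (ExtClosure D R) → ∀ μ1 μ2, R μ1 μ2 → BoxEq D μ1 μ2)) ∧
    (∀ P Q : Tm, P.IsProc → Q.IsProc →
      ((∀ ϑ : FinDist Tm, Is1aryDist ϑ → chiMayL (ϑ.instD P) = chiMayL (ϑ.instD Q)) →
        DiamondEq D (FinDist.dirac P) (FinDist.dirac Q)) ∧
      ((∀ ϑ : FinDist Tm, Is1aryDist ϑ → chiFairL (ϑ.instD P) = chiFairL (ϑ.instD Q)) →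
        BoxEq D (FinDist.dirac P) (FinDist.dirac Q))) := by
  refine ⟨?_, ?_, ?_⟩
  · intro μ1 μ2 _ _ h
    have h' : DSim μ1 μ2 := h.ilift strongBisim_equiv
    exact ⟨⟨DSim, fun _ _ h => h.chiMayL, dsim_extensional D, h'⟩,
      ⟨DSim, fun _ _ h => h.chiFairL, dsim_extensional D, h'⟩⟩
  · intro R
    refine ⟨fun hR μ1 μ2 h => ?_, fun hR μ1 μ2 h => ?_⟩
    · refine ⟨ExtUpTo D R, ?_, extUpTo_extensional D hD R,
        ⟨μ1, μ2, .base h, .refl _, .refl _⟩⟩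
      rintro ν1 ν2 ⟨ν1', ν2', hc, h1, h2⟩
      rw [h1.chiMayL, h2.chiMayL]
      exact hR _ _ hc
    · refine ⟨ExtUpTo D R, ?_, extUpTo_extensional D hD R,
        ⟨μ1, μ2, .base h, .refl _, .refl _⟩⟩
      rintro ν1 ν2 ⟨ν1', ν2', hc, h1, h2⟩
      rw [h1.chiFairL, h2.chiFairL]
      exact hR _ _ hc
  · intro P Q _ _
    refine ⟨fun h => ⟨InstRel P Q, ?_, instRel_extensional D hD P Q, instRel_dirac P Q⟩,
      fun h => ⟨InstRel P Q, ?_, instRel_extensional D hD P Q, instRel_dirac P Q⟩⟩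
    · rintro _ _ ⟨ϑ, hϑ, rfl, rfl⟩
      exact h ϑ hϑ
    · rintro _ _ ⟨ϑ, hϑ, rfl, rfl⟩
      exact h ϑ hϑ
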